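/- Under the stated setup, assume 0 < δ < 1, that for every k the matrix φ₂^k is nonexpansive (‖φ₂^k x‖ ≤ ‖x‖ for all x ∈ ℝ^{N₂}), and that the lower JL inequality holds for every k: ‖φ₂^k (I₂ₖ − A^k I₁)‖ ≥ (1−δ)‖I₂ₖ − A^k I₁‖. Then the compressed-domain data cost is bounded below by E_d ≥ (1−δ)² Ẽ_d − C_l, where C_l = η² + 2(1−δ) α η. (Lower bound of Proposition 1.) -/

import Mathlib

open Matrix Finset

/-- For nonnegative families, the sum of products is at most the product of the sums. -/
theorem Finset.sum_mul_le_sum_mul_sum_of_nonneg {ι : Type*} (s : Finset ι) (f g : ι → ℝ)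
    (hf : ∀ i ∈ s, 0 ≤ f i) (hg : ∀ i ∈ s, 0 ≤ g i) :
    ∑ i ∈ s, f i * g i ≤ (∑ i ∈ s, f i) * ∑ i ∈ s, g i := by
  rw [Finset.sum_mul]
  exact Finset.sum_le_sum fun i hi =>
    mul_le_mul_of_nonneg_left (Finset.single_le_sum hg hi) (hf i hi)

/-- A squared form of the reverse triangle inequality. -/
theorem sq_sub_sq_add_le_norm_sub_sq {E : Type*} [SeminormedAddCommGroup E] {x y : E} {b e : ℝ}
    (hb : 0 ≤ b) (hx : b ≤ ‖x‖) (hy : ‖y‖ ≤ e) :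
    b ^ 2 - (e ^ 2 + 2 * b * e) ≤ ‖x - y‖ ^ 2 := by
  have he : 0 ≤ e := (norm_nonneg y).trans hy
  have hr : b - e ≤ ‖x - y‖ := by linarith [norm_sub_norm_le x y]
  rcases le_total b e with h | h
  · nlinarith [mul_nonneg hb he, sq_nonneg ‖x - y‖]
  · nlinarith [pow_le_pow_left₀ (sub_nonneg.2 h) hr 2, sq_nonneg e]

/-- Lower bound of Proposition 1: `E_d ≥ (1−δ)² Ẽ_d − C_l` with
`C_l = η² + 2(1−δ) α η`. -/
theorem prop1_lower_bound
    (N₁ N₂ N M K : ℕ) (hN₁ : 0 < N₁) (hN₂ : 0 < N₂) (hN : 0 < N) (hM : 0 < M) (hK : 0 < K)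
    (A : Fin N₁ → Matrix (Fin N₂) (Fin N) ℝ)
    (φ₂ : Fin N₁ → Matrix (Fin M) (Fin N₂) ℝ)
    (Φ₁ : Matrix (Fin K) (Fin N) ℝ)
    (I₁ : EuclideanSpace ℝ (Fin N))
    (I₂ : Fin N₁ → EuclideanSpace ℝ (Fin N₂))
    (δ : ℝ) (hδ0 : 0 < δ) (hδ1 : δ < 1)
    (hnonexp : ∀ (k : Fin N₁) (x : EuclideanSpace ℝ (Fin N₂)),
      ‖Matrix.toEuclideanLin (φ₂ k) x‖ ≤ ‖x‖)
    (hJL : ∀ k : Fin N₁,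
      (1 - δ) * ‖I₂ k - Matrix.toEuclideanLin (A k) I₁‖
        ≤ ‖Matrix.toEuclideanLin (φ₂ k) (I₂ k - Matrix.toEuclideanLin (A k) I₁)‖) :
    -- `E_d ≥ (1−δ)² Ẽ_d − (η² + 2(1−δ) α η)`
    (1 - δ) ^ 2 * (∑ k : Fin N₁, ‖I₂ k - Matrix.toEuclideanLin (A k) I₁‖ ^ 2)
      - ((∑ k : Fin N₁,
            ‖Matrix.toEuclideanLin (A k) (Matrix.toEuclideanLin (Φ₁ᵀ * Φ₁) I₁ - I₁)‖) ^ 2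
        + 2 * (1 - δ) * (∑ k : Fin N₁, ‖I₂ k - Matrix.toEuclideanLin (A k) I₁‖)
          * (∑ k : Fin N₁,
              ‖Matrix.toEuclideanLin (A k) (Matrix.toEuclideanLin (Φ₁ᵀ * Φ₁) I₁ - I₁)‖))
      ≤ ∑ k : Fin N₁, ‖Matrix.toEuclideanLin (φ₂ k) (I₂ k) -
          Matrix.toEuclideanLin (φ₂ k * A k * Φ₁ᵀ * Φ₁) I₁‖ ^ 2 := by
  set a : Fin N₁ → ℝ := fun k => ‖I₂ k - Matrix.toEuclideanLin (A k) I₁‖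
  set e : Fin N₁ → ℝ := fun k =>
    ‖Matrix.toEuclideanLin (A k) (Matrix.toEuclideanLin (Φ₁ᵀ * Φ₁) I₁ - I₁)‖
  have hc : 0 ≤ 1 - δ := by linarith
  have ha0 : ∀ k ∈ univ, 0 ≤ a k := fun k _ => norm_nonneg _
  have he0 : ∀ k ∈ univ, 0 ≤ e k := fun k _ => norm_nonneg _
  have residual (k : Fin N₁) :
      Matrix.toEuclideanLin (φ₂ k) (I₂ k) - Matrix.toEuclideanLin (φ₂ k * A k * Φ₁ᵀ * Φ₁) I₁ =
        Matrix.toEuclideanLin (φ₂ k) (I₂ k - Matrix.toEuclideanLin (A k) I₁) -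
          Matrix.toEuclideanLin (φ₂ k) (Matrix.toEuclideanLin (A k)
            (Matrix.toEuclideanLin (Φ₁ᵀ * Φ₁) I₁ - I₁)) := by
    have hmul : Matrix.toEuclideanLin (φ₂ k * A k * Φ₁ᵀ * Φ₁) I₁ =
        Matrix.toEuclideanLin (φ₂ k) (Matrix.toEuclideanLin (A k)
          (Matrix.toEuclideanLin (Φ₁ᵀ * Φ₁) I₁)) := by
      simp [Matrix.toLpLin_apply, Matrix.mulVec_mulVec, Matrix.mul_assoc]
    rw [hmul]
    simp only [map_sub]
    abel
  have hsum : ∑ k, (((1 - δ) * a k) ^ 2 - (e k ^ 2 + 2 * ((1 - δ) * a k) * e k)) ≤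
      ∑ k, ‖Matrix.toEuclideanLin (φ₂ k) (I₂ k) -
        Matrix.toEuclideanLin (φ₂ k * A k * Φ₁ᵀ * Φ₁) I₁‖ ^ 2 := by
    refine Finset.sum_le_sum fun k hk => ?_
    rw [residual k]
    exact sq_sub_sq_add_le_norm_sub_sq (mul_nonneg hc (ha0 k hk)) (hJL k) (hnonexp k _)
  have hexpand : ∑ k, (((1 - δ) * a k) ^ 2 - (e k ^ 2 + 2 * ((1 - δ) * a k) * e k)) =
      (1 - δ) ^ 2 * ∑ k, a k ^ 2 - (∑ k, e k * e k + 2 * (1 - δ) * ∑ k, a k * e k) := by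
    simp only [Finset.mul_sum, ← Finset.sum_add_distrib, ← Finset.sum_sub_distrib]
    exact Finset.sum_congr rfl fun k _ => by ring
  have hee := Finset.sum_mul_le_sum_mul_sum_of_nonneg univ e e he0 he0
  have hae := mul_le_mul_of_nonneg_left
    (Finset.sum_mul_le_sum_mul_sum_of_nonneg univ a e ha0 he0) (mul_nonneg zero_le_two hc)
  rw [hexpand] at hsum
  linarith
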